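/- arXiv:1812.06180 — 7 statements merged into one kernel-verified Lean document; each statement's English description precedes it below -/
import Mathlib

section
/- Let n ≥ 2 and let r_1, …, r_n be an admissible root sequence (for each 1 ≤ j ≤ n−1: r_{j+1} − r_j is even, r_{j+1} − r_j ≥ −2, and r_{j+1} ≠ r_j) which additionally satisfies r_n < r_1. For k ∈ ℤ let m_k be the number of indices j ∈ {1,…,n} with r_j = k. Then for every k ∈ ℤ one has m_k ≤ m_{k−2} + m_{k+2}. -/
/-- Three-term inequality for multiplicities of an admissible root
sequence `r 1, …, r n` with `r n < r 1`. -/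
theorem three_term_inequality (n : ℕ) (hn : 2 ≤ n) (r : ℕ → ℤ)
    (hadm : ∀ j, 1 ≤ j → j < n →
      Even (r (j + 1) - r j) ∧ r (j + 1) - r j ≥ -2 ∧ r (j + 1) ≠ r j)
    (hend : r n < r 1) (k : ℤ) :
    ((Finset.Icc 1 n).filter (fun j => r j = k)).card ≤
      ((Finset.Icc 1 n).filter (fun j => r j = k - 2)).card +
      ((Finset.Icc 1 n).filter (fun j => r j = k + 2)).card := by
  by_cases hpar : Even (r 1 - k)
  · have key : ∀ t, 1 ≤ t → t ≤ n → Even (r t - k) ∧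
        (((Finset.Icc 1 t).filter (fun j => r j = k)).card : ℤ) +
          (if r t < k ∨ r t = k + 2 then 1 else 0) ≤
        ((Finset.Icc 1 t).filter (fun j => r j = k - 2)).card +
        ((Finset.Icc 1 t).filter (fun j => r j = k + 2)).card +
          (if r 1 ≤ k then 1 else 0) := by
      intro t ht
      induction t, ht using Nat.le_induction with
      | base =>
        intro _
        refine ⟨hpar, ?_⟩
        simp only [Finset.Icc_self, Finset.filter_singleton]
        split_ifs <;> simp <;> omega
      | succ t ht ih =>
        intro htn
        obtain ⟨he, hi⟩ := ih (by omega)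
        obtain ⟨h1, h2, h3⟩ := hadm t ht (by omega)
        obtain ⟨a, ha⟩ := he
        obtain ⟨b, hb⟩ := h1
        refine ⟨⟨a + b, by omega⟩, ?_⟩
        have hstep : ∀ c : ℤ, ((Finset.Icc 1 (t + 1)).filter (fun j => r j = c)).card =
            ((Finset.Icc 1 t).filter (fun j => r j = c)).card +
              (if r (t + 1) = c then 1 else 0) := by
          intro c
          rw [← Finset.insert_Icc_right_eq_Icc_add_one (by omega), Finset.filter_insert]
          split_ifs
          · rw [Finset.card_insert_of_notMem (by simp)]
          · rfl
        rw [hstep, hstep, hstep]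
        push_cast
        split_ifs at hi ⊢ <;> omega
    obtain ⟨⟨a, ha⟩, h⟩ := key n (by omega) le_rfl
    split_ifs at h <;> omega
  · have key : ∀ t, 1 ≤ t → t ≤ n → ¬ Even (r t - k) := by
      intro t ht
      induction t, ht using Nat.le_induction with
      | base => exact fun _ => hpar
      | succ t ht ih =>
        intro htn he
        have h1 := (hadm t ht (by omega)).1
        apply ih (by omega)
        have := he.sub h1
        simpa using this
    rw [Finset.filter_eq_empty_iff.2]
    · simp
    · intro j hj hjk
      rw [Finset.mem_Icc] at hj
      exact key j hj.1 hj.2 (by simp [hjk])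
end

section
/- Let τ ∈ ℂ with τ ≠ conj(τ) and let λ ∈ ℂ. Define a_λ(τ) = (τ−τ̄)⁻¹ · [[τ − λτ̄, (λ−1)ττ̄], [1 − λ, λτ − τ̄]], where τ̄ = conj(τ). Then a_λ(τ) · Θ(τ) = λ · (Θ(τ) · a_λ(τ)). Equivalently, when λ ≠ 0 (so that a_λ(τ) is invertible, having determinant λ), conjugation by a_λ(τ) rescales the Higgs field: a_λ(τ) · Θ(τ) · a_λ(τ)⁻¹ = λ · Θ(τ). -/
open ComplexConjugate Matrix

/-- The matrix `Θ(τ)` of the Higgs field. -/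
noncomputable def Θmat (τ : ℂ) : Matrix (Fin 2) (Fin 2) ℂ :=
  ((τ - conj τ) ^ 2)⁻¹ • !![-(conj τ), (conj τ) ^ 2; -1, conj τ]

/-- The gauge transformation `a_λ(τ)`. -/
noncomputable def aMat (l τ : ℂ) : Matrix (Fin 2) (Fin 2) ℂ :=
  (τ - conj τ)⁻¹ •
    !![τ - l * conj τ, (l - 1) * τ * conj τ; 1 - l, l * τ - conj τ]

/-- `a_λ(τ)` intertwines `Θ(τ)` and `λ·Θ(τ)`; it has determinant `λ`,
and when `λ ≠ 0` conjugation by it rescales the Higgs field by `λ`. -/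
theorem a_lambda_intertwines (τ : ℂ) (h : τ ≠ conj τ) (l : ℂ) :
    aMat l τ * Θmat τ = l • (Θmat τ * aMat l τ) ∧
    (aMat l τ).det = l ∧
    (l ≠ 0 → aMat l τ * Θmat τ * (aMat l τ)⁻¹ = l • Θmat τ) := by
  have hd : τ - conj τ ≠ 0 := sub_ne_zero.mpr h
  have h1 : aMat l τ * Θmat τ = l • (Θmat τ * aMat l τ) := by
    unfold aMat Θmat
    generalize conj τ = s at *
    ext i j
    fin_cases i <;> fin_cases j <;> simp [Matrix.mul_apply, Fin.sum_univ_two] <;> ring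
  have h2 : (aMat l τ).det = l := by
    unfold aMat
    generalize conj τ = s at *
    simp [Matrix.det_fin_two]
    field_simp
    ring
  refine ⟨h1, h2, fun hl => ?_⟩
  have hu : IsUnit (aMat l τ).det := by rw [h2]; exact hl.isUnit
  rw [h1, Matrix.smul_mul, Matrix.mul_assoc, Matrix.mul_nonsing_inv _ hu, Matrix.mul_one]
end

section
/- Let γ = [[a, b], [c, d]] be a real 2×2 matrix with ad − bc = 1, and let τ ∈ ℂ with Im(τ) > 0. Set γτ = (aτ + b)/(cτ + d) (note cτ + d ≠ 0). Then, as 2×2 complex matrices, γ · M(τ) = M(γτ) · diag((cτ + d)⁻¹, cτ + d). -/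
open ComplexConjugate Matrix

/-- The change-of-frame matrix `M(τ)`. -/
noncomputable def Mmat (τ : ℂ) : Matrix (Fin 2) (Fin 2) ℂ :=
  !![-(conj τ) / (τ - conj τ), τ; -1 / (τ - conj τ), 1]

/-- the automorphy identity `γ · M(τ) = M(γτ) · diag((cτ+d)⁻¹, cτ+d)`. -/
theorem Mmat_automorphy (a b c d : ℝ) (hdet : a * d - b * c = 1)
    (τ : ℂ) (hτ : 0 < τ.im) :
    (c : ℂ) * τ + d ≠ 0 ∧
    (!![(a : ℂ), b; c, d] : Matrix (Fin 2) (Fin 2) ℂ) * Mmat τ =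
      Mmat (((a : ℂ) * τ + b) / ((c : ℂ) * τ + d)) *
        !![((c : ℂ) * τ + d)⁻¹, 0; 0, (c : ℂ) * τ + d] := by
  have hj : (c : ℂ) * τ + d ≠ 0 := by
    intro h
    have him := congrArg Complex.im h
    have hre := congrArg Complex.re h
    simp at him hre
    rcases him with hc | h0
    · subst hc
      have hd : d = 0 := by simpa using hre
      subst hd
      simp at hdet
    · exact hτ.ne' h0
  refine ⟨hj, ?_⟩
  have hjc : (c : ℂ) * conj τ + d ≠ 0 := by
    intro h
    apply hj
    have h2 := congrArg conj h
    simpa using h2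
  have ht : τ - conj τ ≠ 0 := by
    intro h
    have him := congrArg Complex.im h
    simp at him
    linarith
  have hdet' : (a : ℂ) * d - b * c = 1 := by exact_mod_cast hdet
  have hconj : conj (((a : ℂ) * τ + b) / ((c : ℂ) * τ + d)) =
      ((a : ℂ) * conj τ + b) / ((c : ℂ) * conj τ + d) := by simp
  have hdiff : ((a : ℂ) * τ + b) / ((c : ℂ) * τ + d) -
      ((a : ℂ) * conj τ + b) / ((c : ℂ) * conj τ + d) =
      (τ - conj τ) / (((c : ℂ) * τ + d) * ((c : ℂ) * conj τ + d)) := by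
    rw [div_sub_div _ _ hj hjc]
    congr 1
    linear_combination (τ - conj τ) * hdet'
  unfold Mmat
  rw [hconj, hdiff]
  clear hconj hdiff
  generalize conj τ = σ at *
  generalize hJ : (c : ℂ) * τ + d = J at hj ⊢
  generalize hK : (c : ℂ) * σ + d = K at hjc ⊢
  ext i j
  fin_cases i <;> fin_cases j <;> simp [Matrix.mul_apply, Fin.sum_univ_two] <;>
    field_simp <;>
    first
      | done
      | ring1
      | linear_combination hJ
      | linear_combination -hK
      | linear_combination hK
end

section
/- Let γ = [[a, b], [c, d]] be a real 2×2 matrix with ad − bc = 1, let k ∈ ℤ, and let f : ℍ → ℂ², g, h : ℍ → ℂ be functions on the upper half plane ℍ satisfying f(τ) = M(τ) · (g(τ), h(τ))ᵀ for all τ ∈ ℍ. If f(γτ) = (cτ + d)^k · γ · f(τ) for all τ ∈ ℍ, where γτ = (aτ + b)/(cτ + d), then g(γτ) = (cτ + d)^{k−1} g(τ) and h(γτ) = (cτ + d)^{k+1} h(τ) for all τ ∈ ℍ. -/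
open ComplexConjugate Matrix

/-- if `f = M(τ)·(g,h)ᵀ` transforms with weight `k` under `γ` and the
inclusion representation, then `g` and `h` transform with weights `k - 1` and `k + 1`. -/
theorem scalar_components_modular (a b c d : ℝ) (hdet : a * d - b * c = 1)
    (k : ℤ) (f : ℂ → Fin 2 → ℂ) (g h : ℂ → ℂ)
    (hf : ∀ τ : ℂ, 0 < τ.im → f τ = Mmat τ *ᵥ ![g τ, h τ])
    (hauto : ∀ τ : ℂ, 0 < τ.im →
      f (((a : ℂ) * τ + b) / ((c : ℂ) * τ + d)) =
        ((c : ℂ) * τ + d) ^ k •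
          ((!![(a : ℂ), b; c, d] : Matrix (Fin 2) (Fin 2) ℂ) *ᵥ f τ)) :
    ∀ τ : ℂ, 0 < τ.im →
      g (((a : ℂ) * τ + b) / ((c : ℂ) * τ + d)) =
        ((c : ℂ) * τ + d) ^ (k - 1) * g τ ∧
      h (((a : ℂ) * τ + b) / ((c : ℂ) * τ + d)) =
        ((c : ℂ) * τ + d) ^ (k + 1) * h τ := by
  intro τ hτ
  have hdetC : (a : ℂ) * d - b * c = 1 := by exact_mod_cast hdet
  have hj : (c : ℂ) * τ + d ≠ 0 := by
    intro h0
    have him := congrArg Complex.im h0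
    have hre := congrArg Complex.re h0
    simp at him hre
    rcases him with hc | hc
    · subst hc
      simp at hre
      subst hre
      simp at hdet
    · exact hτ.ne' hc
  have hjc : (c : ℂ) * conj τ + d ≠ 0 := by
    intro h0
    apply hj
    have := congrArg conj h0
    simpa using this
  have hsub : τ - conj τ ≠ 0 := by
    intro h0
    have him := congrArg Complex.im h0
    simp at him
    linarith
  have hwc : conj (((a : ℂ) * τ + b) / ((c : ℂ) * τ + d))
      = ((a : ℂ) * conj τ + b) / ((c : ℂ) * conj τ + d) := by simp
  have hdiff : ((a : ℂ) * τ + b) / ((c : ℂ) * τ + d)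
      - ((a : ℂ) * conj τ + b) / ((c : ℂ) * conj τ + d)
      = (τ - conj τ) / (((c : ℂ) * τ + d) * ((c : ℂ) * conj τ + d)) := by
    rw [div_sub_div _ _ hj hjc]
    congr 1
    linear_combination (τ - conj τ) * hdetC
  have hwim : 0 < (((a : ℂ) * τ + b) / ((c : ℂ) * τ + d)).im := by
    have hn : 0 < Complex.normSq ((c : ℂ) * τ + d) := Complex.normSq_pos.2 hj
    have : (((a : ℂ) * τ + b) / ((c : ℂ) * τ + d)).im
        = τ.im / Complex.normSq ((c : ℂ) * τ + d) := by
      rw [Complex.div_im, ← sub_div]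
      congr 1
      simp
      linear_combination τ.im * hdet
    rw [this]
    positivity
  have key := hauto τ hτ
  rw [hf _ hwim, hf τ hτ] at key
  have e1 := congrFun key 0
  have e2 := congrFun key 1
  simp only [Mmat, hwc, hdiff] at e1 e2
  simp [Matrix.mulVec, dotProduct, Fin.sum_univ_two, -map_div₀, -map_add, -map_mul] at e1 e2
  rw [zpow_sub_one₀ hj, zpow_add_one₀ hj]
  generalize g (((a : ℂ) * τ + b) / ((c : ℂ) * τ + d)) = g' at *
  generalize h (((a : ℂ) * τ + b) / ((c : ℂ) * τ + d)) = h' at *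
  generalize ((c : ℂ) * τ + d) ^ k = P at *
  generalize g τ = G at *
  generalize h τ = H at *
  generalize conj τ = σ at *
  clear key hauto hf
  clear hwc hdiff hwim
  have hA : ((a : ℂ) * τ + b) * (c * σ + d) - (a * σ + b) * (c * τ + d) = τ - σ := by
    linear_combination (τ - σ) * hdetC
  have r1 : (a : ℂ) * (G * (-σ / (τ - σ)) + H * τ) + b * (G * (-1 / (τ - σ)) + H)
      = H * (a * τ + b) - G * (a * σ + b) / (τ - σ) := by ring
  have r2 : (c : ℂ) * (G * (-σ / (τ - σ)) + H * τ) + d * (G * (-1 / (τ - σ)) + H)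
      = H * (c * τ + d) - G * (c * σ + d) / (τ - σ) := by ring
  rw [r1] at e1
  rw [r2] at e2
  clear r1 r2
  generalize (c : ℂ) * τ + d = J at *
  generalize (c : ℂ) * σ + d = K at *
  generalize (a : ℂ) * τ + b = A at *
  generalize (a : ℂ) * σ + b = B at *
  generalize τ - σ = D at *
  have e1' : -B * J ^ 2 * g' + A * D * h' = P * J * (D * A * H - B * G) := by
    have h1 : -(B / K) / (D / (J * K)) * g' + A / J * h'
        = (-B * J ^ 2 * g' + A * D * h') / (J * D) := by field_simp
    have h2 : P * (H * A - G * B / D) = P * J * (D * A * H - B * G) / (J * D) := by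
      field_simp
    rw [h1, h2] at e1
    exact (div_left_inj' (mul_ne_zero hj hsub)).1 e1
  have e2' : -J * K * g' + D * h' = P * (D * J * H - K * G) := by
    have h1 : -1 / (D / (J * K)) * g' + h' = (-J * K * g' + D * h') / D := by field_simp
    have h2 : P * (H * J - G * K / D) = P * (D * J * H - K * G) / D := by
      field_simp
    rw [h1, h2] at e2
    exact (div_left_inj' hsub).1 e2
  constructor
  · have : g' * J = P * G := by
      apply mul_right_cancel₀ hsub
      linear_combination e1' - A * e2' + (P * G - g' * J) * hA
        + 0 * hA
    field_simp
    linear_combination this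
  · apply mul_right_cancel₀ (pow_ne_zero 2 hsub)
    linear_combination K * e1' - J * B * e2' - (h' * D - P * J * H * D) * hA
end

section
/- Let f₁, f₂ : ℂ → ℂ be real-differentiable at every point of the upper half plane ℍ and satisfy the Higgs system: for all τ ∈ ℍ, ∂̄f₁(τ) = (−τ f₁(τ) + τ² f₂(τ))/(τ − τ̄)² and ∂̄f₂(τ) = (−f₁(τ) + τ f₂(τ))/(τ − τ̄)². Then the function g(τ) := f₁(τ) − τ f₂(τ) is complex-differentiable (holomorphic) at every point of ℍ. -/
open ComplexConjugate

/-- The Cauchy–Riemann operator `∂̄f(τ) = ½(Df(τ)(1) + i·Df(τ)(i))`. -/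
noncomputable def dbar (f : ℂ → ℂ) (τ : ℂ) : ℂ :=
  (1 / 2 : ℂ) * (fderiv ℝ f τ 1 + Complex.I * fderiv ℝ f τ Complex.I)

/-- for solutions `(f₁, f₂)` of the Higgs system on the upper half
plane, the function `g(τ) = f₁(τ) - τ·f₂(τ)` is holomorphic on the upper half plane. -/
theorem g_holomorphic (f₁ f₂ : ℂ → ℂ)
    (hdiff : ∀ τ : ℂ, 0 < τ.im →
      DifferentiableAt ℝ f₁ τ ∧ DifferentiableAt ℝ f₂ τ)
    (heq1 : ∀ τ : ℂ, 0 < τ.im →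
      dbar f₁ τ = (-τ * f₁ τ + τ ^ 2 * f₂ τ) / (τ - conj τ) ^ 2)
    (heq2 : ∀ τ : ℂ, 0 < τ.im →
      dbar f₂ τ = (-f₁ τ + τ * f₂ τ) / (τ - conj τ) ^ 2) :
    ∀ τ : ℂ, 0 < τ.im →
      DifferentiableAt ℂ (fun z => f₁ z - z * f₂ z) τ := by
  intro τ hτ
  obtain ⟨h1, h2⟩ := hdiff τ hτ
  have e1 := heq1 τ hτ
  have e2 := heq2 τ hτ
  have hg : HasFDerivAt (𝕜 := ℝ) (fun z => f₁ z - z * f₂ z)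
      (fderiv ℝ f₁ τ - (τ • fderiv ℝ f₂ τ + f₂ τ • ContinuousLinearMap.id ℝ ℂ)) τ :=
    h1.hasFDerivAt.sub ((hasFDerivAt_id τ).mul h2.hasFDerivAt)
  have e : dbar f₁ τ = τ * dbar f₂ τ := by
    rw [e1, e2]; ring
  refine differentiableAt_complex_iff_differentiableAt_real.2 ⟨hg.differentiableAt, ?_⟩
  rw [hg.fderiv]
  simp only [ContinuousLinearMap.sub_apply, ContinuousLinearMap.add_apply,
    ContinuousLinearMap.smul_apply, ContinuousLinearMap.id_apply, smul_eq_mul]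
  unfold dbar at e
  linear_combination (-2 * Complex.I) * e + (fderiv ℝ f₁ τ Complex.I -
    τ * fderiv ℝ f₂ τ Complex.I) * Complex.I_sq
end

section
/- Let f₁, f₂ : ℂ → ℂ be real-differentiable at every point of the upper half plane ℍ and satisfy the Higgs system: for all τ ∈ ℍ, ∂̄f₁(τ) = (−τ f₁(τ) + τ² f₂(τ))/(τ − τ̄)² and ∂̄f₂(τ) = (−f₁(τ) + τ f₂(τ))/(τ − τ̄)². Then the function h(τ) := f₂(τ) + (f₁(τ) − τ f₂(τ))/(τ − τ̄) is complex-differentiable (holomorphic) at every point of ℍ. -/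
open ComplexConjugate

/-- for solutions `(f₁, f₂)` of the Higgs system on the upper half
plane, the function `h(τ) = f₂(τ) + (f₁(τ) - τ·f₂(τ))/(τ - τ̄)` is holomorphic. -/
theorem h_holomorphic (f₁ f₂ : ℂ → ℂ)
    (hdiff : ∀ τ : ℂ, 0 < τ.im →
      DifferentiableAt ℝ f₁ τ ∧ DifferentiableAt ℝ f₂ τ)
    (heq1 : ∀ τ : ℂ, 0 < τ.im →
      dbar f₁ τ = (-τ * f₁ τ + τ ^ 2 * f₂ τ) / (τ - conj τ) ^ 2)
    (heq2 : ∀ τ : ℂ, 0 < τ.im →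
      dbar f₂ τ = (-f₁ τ + τ * f₂ τ) / (τ - conj τ) ^ 2) :
    ∀ τ : ℂ, 0 < τ.im →
      DifferentiableAt ℂ
        (fun z => f₂ z + (f₁ z - z * f₂ z) / (z - conj z)) τ := by
  intro τ hτ
  obtain ⟨h1, h2⟩ := hdiff τ hτ
  have e1 := heq1 τ hτ
  have e2 := heq2 τ hτ
  have hD : τ - conj τ ≠ 0 := by
    intro h
    have := congrArg Complex.im h
    simp at this
    linarith
  have dD : HasFDerivAt (fun z : ℂ => z - conj z)
      (ContinuousLinearMap.id ℝ ℂ - (Complex.conjCLE : ℂ →L[ℝ] ℂ)) τ :=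
    (hasFDerivAt_id τ).sub (Complex.conjCLE : ℂ →L[ℝ] ℂ).hasFDerivAt
  have dI := ((hasDerivAt_inv hD).hasFDerivAt.restrictScalars ℝ).comp τ dD
  have dh := h2.hasFDerivAt.add
    ((h1.hasFDerivAt.sub ((hasFDerivAt_id (𝕜 := ℝ) τ).mul h2.hasFDerivAt)).mul dI)
  have dh' : HasFDerivAt (fun z => f₂ z + (f₁ z - z * f₂ z) / (z - conj z)) _ τ := dh
  rw [differentiableAt_complex_iff_differentiableAt_real]
  refine ⟨dh'.differentiableAt, ?_⟩
  rw [dh'.fderiv]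
  unfold dbar at e1 e2
  generalize fderiv ℝ f₁ τ = A at *
  generalize fderiv ℝ f₂ τ = B at *
  simp
  have hA : A Complex.I = Complex.I * A 1 - 2 * Complex.I *
      ((-τ * f₁ τ + τ ^ 2 * f₂ τ) / (τ - conj τ) ^ 2) := by
    rw [← e1]; linear_combination (A Complex.I) * Complex.I_sq
  have hB : B Complex.I = Complex.I * B 1 - 2 * Complex.I *
      ((-f₁ τ + τ * f₂ τ) / (τ - conj τ) ^ 2) := by
    rw [← e2]; linear_combination (B Complex.I) * Complex.I_sq
  rw [hA, hB]
  field_simp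
  ring
end

section
/- Let g, h : ℂ → ℂ be complex-differentiable (holomorphic) at every point of the upper half plane ℍ. Define f₁(τ) := −τ̄ g(τ)/(τ − τ̄) + τ h(τ) and f₂(τ) := −g(τ)/(τ − τ̄) + h(τ). Then f₁ and f₂ are real-differentiable at every point of ℍ and satisfy the Higgs system: for all τ ∈ ℍ, ∂̄f₁(τ) = (−τ f₁(τ) + τ² f₂(τ))/(τ − τ̄)² and ∂̄f₂(τ) = (−f₁(τ) + τ f₂(τ))/(τ − τ̄)². -/
open ComplexConjugate

/-- First component `f₁ = -τ̄ g/(τ - τ̄) + τ h` of the frame applied to `(g, h)`. -/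
noncomputable def F₁ (g h : ℂ → ℂ) (z : ℂ) : ℂ :=
  -(conj z) * g z / (z - conj z) + z * h z

/-- Second component `f₂ = -g/(τ - τ̄) + h` of the frame applied to `(g, h)`. -/
noncomputable def F₂ (g h : ℂ → ℂ) (z : ℂ) : ℂ :=
  -(g z) / (z - conj z) + h z

/-- `f` is real-differentiable at `τ` with `∂̄f(τ) = a`. -/
def HasDbar (f : ℂ → ℂ) (a τ : ℂ) : Prop :=
  DifferentiableAt ℝ f τ ∧ dbar f τ = a

lemma hasDbar_holo {f : ℂ → ℂ} {τ : ℂ} (hf : DifferentiableAt ℂ f τ) : HasDbar f 0 τ := by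
  refine ⟨hf.restrictScalars ℝ, ?_⟩
  have e : fderiv ℝ f τ = (fderiv ℂ f τ).restrictScalars ℝ := hf.fderiv_restrictScalars ℝ
  have h2 : fderiv ℂ f τ Complex.I = Complex.I * fderiv ℂ f τ 1 := by
    have := (fderiv ℂ f τ).map_smul Complex.I 1
    simpa using this
  unfold dbar
  rw [e, ContinuousLinearMap.coe_restrictScalars', h2, ← mul_assoc, Complex.I_mul_I]
  ring

lemma hasDbar_conj (τ : ℂ) : HasDbar (fun z => conj z) 1 τ := by
  have h : HasFDerivAt (fun z : ℂ => conj z) (Complex.conjCLE : ℂ →L[ℝ] ℂ) τ :=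
    Complex.conjCLE.hasFDerivAt
  refine ⟨h.differentiableAt, ?_⟩
  unfold dbar
  rw [h.fderiv]
  simp
  norm_num

lemma HasDbar.add {f k : ℂ → ℂ} {a b τ : ℂ} (hf : HasDbar f a τ) (hk : HasDbar k b τ) :
    HasDbar (fun z => f z + k z) (a + b) τ := by
  obtain ⟨hf, rfl⟩ := hf
  obtain ⟨hk, rfl⟩ := hk
  refine ⟨hf.add hk, ?_⟩
  unfold dbar
  rw [(hf.hasFDerivAt.fun_add hk.hasFDerivAt).fderiv]
  simp
  ring

lemma HasDbar.mul {f k : ℂ → ℂ} {a b τ : ℂ} (hf : HasDbar f a τ) (hk : HasDbar k b τ) :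
    HasDbar (fun z => f z * k z) (f τ * b + k τ * a) τ := by
  obtain ⟨hf, rfl⟩ := hf
  obtain ⟨hk, rfl⟩ := hk
  refine ⟨hf.mul hk, ?_⟩
  unfold dbar
  rw [(hf.hasFDerivAt.fun_mul hk.hasFDerivAt).fderiv]
  simp
  ring

lemma HasDbar.inv {f : ℂ → ℂ} {a τ : ℂ} (hf : HasDbar f a τ) (h0 : f τ ≠ 0) :
    HasDbar (fun z => (f z)⁻¹) (-a / f τ ^ 2) τ := by
  have hd : DifferentiableAt ℝ (fun z => (f z)⁻¹) τ := hf.1.inv h0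
  have h1 : HasDbar (fun z => (f z)⁻¹) (dbar (fun z => (f z)⁻¹) τ) τ := ⟨hd, rfl⟩
  have h2 := (hf.mul h1).2
  have h3 : dbar (fun z => f z * (f z)⁻¹) τ = 0 := by
    have e : (fun z => f z * (f z)⁻¹) =ᶠ[nhds τ] fun _ => (1 : ℂ) := by
      filter_upwards [hf.1.continuousAt.eventually_ne h0] with z hz
      exact mul_inv_cancel₀ hz
    unfold dbar
    rw [e.fderiv_eq]
    simp
  refine ⟨hd, ?_⟩
  rw [h3] at h2
  field_simp at h2 ⊢
  linear_combination -h2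

/-- if `g, h` are holomorphic on the upper half plane, then
`(f₁, f₂) = M(τ)·(g,h)ᵀ` is real-differentiable and solves the Higgs system. -/
theorem frame_solves_higgs_system (g h : ℂ → ℂ)
    (hg : ∀ τ : ℂ, 0 < τ.im → DifferentiableAt ℂ g τ)
    (hh : ∀ τ : ℂ, 0 < τ.im → DifferentiableAt ℂ h τ) :
    ∀ τ : ℂ, 0 < τ.im →
      DifferentiableAt ℝ (F₁ g h) τ ∧
      DifferentiableAt ℝ (F₂ g h) τ ∧
      dbar (F₁ g h) τ =
        (-τ * F₁ g h τ + τ ^ 2 * F₂ g h τ) / (τ - conj τ) ^ 2 ∧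
      dbar (F₂ g h) τ =
        (-F₁ g h τ + τ * F₂ g h τ) / (τ - conj τ) ^ 2 := by
  intro τ hτ
  have h0 : τ + (-1) * conj τ ≠ 0 := by
    intro h
    have := congrArg Complex.im h
    simp at this
    linarith
  have h0' : τ - conj τ ≠ 0 := by
    intro h
    exact h0 (by linear_combination h)
  have hc : ∀ c : ℂ, HasDbar (fun _ => c) 0 τ := fun c => hasDbar_holo (by fun_prop)
  have hid : HasDbar (fun z => z) 0 τ := hasDbar_holo (by fun_prop)
  have hG := hasDbar_holo (hg τ hτ)
  have hH := hasDbar_holo (hh τ hτ)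
  have hn := (hc (-1)).mul (hasDbar_conj τ)
  have hi := (hid.add hn).inv h0
  have k1 := ((hn.mul hG).mul hi).add (hid.mul hH)
  have k2 := (((hc (-1)).mul hG).mul hi).add hH
  have e1 : F₁ g h = fun z => -1 * conj z * g z * (z + -1 * conj z)⁻¹ + z * h z := by
    funext z
    simp only [F₁, div_eq_mul_inv, neg_mul, one_mul, sub_eq_add_neg]
  have e2 : F₂ g h = fun z => -1 * g z * (z + -1 * conj z)⁻¹ + h z := by
    funext z
    simp only [F₂, div_eq_mul_inv, neg_mul, one_mul, sub_eq_add_neg]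
  have e0 : τ + (-1) * conj τ = τ - conj τ := by ring
  rw [← e1] at k1
  rw [← e2] at k2
  refine ⟨k1.1, k2.1, ?_, ?_⟩
  · rw [k1.2]
    simp only [F₁, F₂, e0]
    field_simp
    ring
  · rw [k2.2]
    simp only [F₁, F₂, e0]
    field_simp
    ring
end
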